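/- Let G = (V,E) be a connected undirected graph with n = |V| ≥ 3 vertices, let p ∈ (0,1)^E and λ ∈ [0,1)^V with (1 − p_min)·log n ≤ e^{−40}, and let μ = μ^RC_{E,p,λ}. Then for every T ⊆ E and every e ∈ E, the marginal satisfies μ_e^T ≥ 1 − 3·(1 − p_min)·log n. -/

import Mathlib

open Finset Real

open scoped Classical in
/-- Vertices `u,v` are adjacent via an edge of `S` (edge `e` has endpoints `ends e`). -/
def adjRel {V E : Type} (ends : E → V × V) (S : Finset E) (u v : V) : Prop :=
  ∃ e ∈ S, ends e = (u, v) ∨ ends e = (v, u)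

open scoped Classical in
/-- The connected component of `v` in the graph `(V, S)`. -/
noncomputable def comp {V E : Type} [Fintype V] (ends : E → V × V) (S : Finset E) (v : V) :
    Finset V :=
  Finset.univ.filter (fun u => Relation.ReflTransGen (adjRel ends S) v u)

/-- The set of connected components of the graph `(V, S)`. -/
noncomputable def comps {V E : Type} [Fintype V] [DecidableEq V] (ends : E → V × V) (S : Finset E) :
    Finset (Finset V) :=
  Finset.univ.image (comp ends S)

/-- The random cluster weight of `S ⊆ U` w.r.t. the graph `(V, U)`. -/
noncomputable def rcWeight {V E : Type} [Fintype V] [DecidableEq V] [DecidableEq E]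
    (ends : E → V × V) (p : E → ℝ) (lam : V → ℝ) (U S : Finset E) : ℝ :=
  (∏ e ∈ S, p e) * (∏ e ∈ U \ S, (1 - p e)) * ∏ C ∈ comps ends S, (1 + ∏ v ∈ C, lam v)

/-- The random cluster distribution `μ^RC_{U,p,λ}` on subsets of `U`, w.r.t. the graph `(V, U)`. -/
noncomputable def rcProb {V E : Type} [Fintype V] [DecidableEq V] [DecidableEq E]
    (ends : E → V × V) (p : E → ℝ) (lam : V → ℝ) (U S : Finset E) : ℝ :=
  if S ⊆ U then rcWeight ends p lam U S / ∑ T ∈ U.powerset, rcWeight ends p lam U T else 0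

open scoped Classical in
/-- The Ising weight of `T ⊆ V`: product of `β_e` over monochromatic edges times
product of `λ_v` over `v ∈ T`. -/
noncomputable def isingWeight {V E : Type} [Fintype E] [DecidableEq V]
    (ends : E → V × V) (β : E → ℝ) (lam : V → ℝ) (T : Finset V) : ℝ :=
  (∏ e ∈ Finset.univ.filter (fun e : E => ((ends e).1 ∈ T ↔ (ends e).2 ∈ T)), β e) *
    ∏ v ∈ T, lam v

/-- The Ising Gibbs distribution `μ^Ising_{β,λ}` on subsets of `V`. -/
noncomputable def isingProb {V E : Type} [Fintype V] [Fintype E] [DecidableEq V]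
    (ends : E → V × V) (β : E → ℝ) (lam : V → ℝ) (T : Finset V) : ℝ :=
  isingWeight ends β lam T / ∑ T' : Finset V, isingWeight ends β lam T'

/-- The graph with edge endpoints `ends` is connected. -/
def GraphConnected {V E : Type} [Fintype E] (ends : E → V × V) : Prop :=
  ∀ u v : V, Relation.ReflTransGen (adjRel ends Finset.univ) u v

/-- The marginal probability `μ_e^X = μ(X∪{e}) / (μ(X∪{e}) + μ(X\{e}))`. -/
noncomputable def marg {E : Type} [DecidableEq E] (μ : Finset E → ℝ) (X : Finset E) (e : E) : ℝ :=
  μ (insert e X) / (μ (insert e X) + μ (X.erase e))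

lemma adjRel_symm {V E : Type} (ends : E → V × V) (S : Finset E) {u v : V}
    (h : adjRel ends S u v) : adjRel ends S v u := by
  obtain ⟨e, he, h⟩ := h
  exact ⟨e, he, h.symm⟩

lemma rtg_symm {V E : Type} (ends : E → V × V) (S : Finset E) {u v : V}
    (h : Relation.ReflTransGen (adjRel ends S) u v) :
    Relation.ReflTransGen (adjRel ends S) v u := by
  induction h with
  | refl => exact .refl
  | tail _ h2 ih => exact .head (adjRel_symm ends S h2) ih

lemma mem_comp_iff {V E : Type} [Fintype V] (ends : E → V × V) (S : Finset E) (u v : V) :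
    u ∈ comp ends S v ↔ Relation.ReflTransGen (adjRel ends S) v u := by
  simp [comp]

lemma comp_eq_of_mem {V E : Type} [Fintype V] (ends : E → V × V) (S : Finset E) {u v : V}
    (h : u ∈ comp ends S v) : comp ends S v = comp ends S u := by
  rw [mem_comp_iff] at h
  ext z
  rw [mem_comp_iff, mem_comp_iff]
  exact ⟨fun k => (rtg_symm ends S h).trans k, fun k => h.trans k⟩

lemma self_mem_comp {V E : Type} [Fintype V] (ends : E → V × V) (S : Finset E) (u : V) :
    u ∈ comp ends S u := by
  rw [mem_comp_iff]

lemma rtg_insert {V E : Type} [DecidableEq E] (ends : E → V × V) (X : Finset E) (e : E)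
    (w z : V) :
    Relation.ReflTransGen (adjRel ends (insert e X)) w z ↔
      Relation.ReflTransGen (adjRel ends X) w z ∨
      ((Relation.ReflTransGen (adjRel ends X) w (ends e).1 ∨
        Relation.ReflTransGen (adjRel ends X) w (ends e).2) ∧
       (Relation.ReflTransGen (adjRel ends X) (ends e).1 z ∨
        Relation.ReflTransGen (adjRel ends X) (ends e).2 z)) := by
  have mono : ∀ {a b : V}, Relation.ReflTransGen (adjRel ends X) a b →
      Relation.ReflTransGen (adjRel ends (insert e X)) a b := by
    intro a b h
    refine Relation.ReflTransGen.mono ?_ _ _ h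
    rintro a b ⟨f, hf, h⟩
    exact ⟨f, Finset.mem_insert_of_mem hf, h⟩
  have h12 : Relation.ReflTransGen (adjRel ends (insert e X)) (ends e).1 (ends e).2 :=
    .single ⟨e, Finset.mem_insert_self _ _, Or.inl rfl⟩
  have h21 := rtg_symm _ _ h12
  constructor
  · intro h
    induction h with
    | refl => exact Or.inl .refl
    | tail _ h2 ih =>
      obtain ⟨f, hf, h⟩ := h2
      rcases Finset.mem_insert.1 hf with rfl | hf
      · rcases h with h | h
        · simp only [h] at ih ⊢
          rcases ih with ih | ih
          · exact Or.inr ⟨Or.inl ih, Or.inr .refl⟩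
          · exact Or.inr ⟨ih.1, Or.inr .refl⟩
        · simp only [h] at ih ⊢
          rcases ih with ih | ih
          · exact Or.inr ⟨Or.inr ih, Or.inl .refl⟩
          · exact Or.inr ⟨ih.1, Or.inl .refl⟩
      · have h3 : adjRel ends X _ _ := ⟨f, hf, h⟩
        rcases ih with ih | ⟨ih, ih2⟩
        · exact Or.inl (ih.tail h3)
        · exact Or.inr ⟨ih, ih2.imp (fun k => k.tail h3) (fun k => k.tail h3)⟩
  · rintro (h | ⟨h1 | h1, h2 | h2⟩)
    · exact mono h
    · exact (mono h1).trans (mono h2)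
    · exact ((mono h1).trans h12).trans (mono h2)
    · exact ((mono h1).trans h21).trans (mono h2)
    · exact (mono h1).trans (mono h2)

lemma comps_prod_le {V E : Type} [Fintype V] [DecidableEq V] [DecidableEq E]
    (ends : E → V × V) (lam : V → ℝ) (hlam : ∀ v, lam v ∈ Set.Ico (0 : ℝ) 1)
    (X : Finset E) (e : E) :
    ∏ C ∈ comps ends X, (1 + ∏ v ∈ C, lam v) ≤
      2 * ∏ C ∈ comps ends (insert e X), (1 + ∏ v ∈ C, lam v) := by
  set u := (ends e).1 with hu
  set v := (ends e).2 with hv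
  set A := comp ends X u with hA
  set B := comp ends X v with hB
  set R := (comps ends X).filter (fun C => u ∉ C ∧ v ∉ C) with hR
  have huA : u ∈ A := self_mem_comp _ _ _
  have hvB : v ∈ B := self_mem_comp _ _ _
  have hX : comps ends X = insert A (insert B R) := by
    ext C
    simp only [hR, Finset.mem_insert, Finset.mem_filter, comps, Finset.mem_image,
      Finset.mem_univ, true_and]
    constructor
    · rintro ⟨w, rfl⟩
      by_cases h1 : u ∈ comp ends X w
      · exact Or.inl (comp_eq_of_mem _ _ h1)
      by_cases h2 : v ∈ comp ends X w
      · exact Or.inr (Or.inl (comp_eq_of_mem _ _ h2))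
      exact Or.inr (Or.inr ⟨⟨w, rfl⟩, h1, h2⟩)
    · rintro (rfl | rfl | h)
      · exact ⟨u, rfl⟩
      · exact ⟨v, rfl⟩
      · exact h.1
  have key1 : ∀ w, (u ∈ comp ends X w ∨ v ∈ comp ends X w) →
      comp ends (insert e X) w = A ∪ B := by
    intro w hw
    ext z
    rw [mem_comp_iff, rtg_insert, Finset.mem_union, hA, hB, mem_comp_iff, mem_comp_iff]
    rw [mem_comp_iff, mem_comp_iff] at hw
    constructor
    · rintro (h | h)
      · exact hw.imp (fun k => (rtg_symm _ _ k).trans h) (fun k => (rtg_symm _ _ k).trans h)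
      · exact h.2
    · exact fun h => Or.inr ⟨hw, h⟩
  have key2 : ∀ w, ¬ (u ∈ comp ends X w ∨ v ∈ comp ends X w) →
      comp ends (insert e X) w = comp ends X w := by
    intro w hw
    ext z
    rw [mem_comp_iff, rtg_insert, mem_comp_iff]
    rw [mem_comp_iff, mem_comp_iff] at hw
    exact ⟨fun h => h.resolve_right (fun k => hw k.1), Or.inl⟩
  have hS : comps ends (insert e X) = insert (A ∪ B) R := by
    ext C
    simp only [hR, Finset.mem_insert, Finset.mem_filter, comps, Finset.mem_image,
      Finset.mem_univ, true_and]
    constructor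
    · rintro ⟨w, rfl⟩
      by_cases h : u ∈ comp ends X w ∨ v ∈ comp ends X w
      · exact Or.inl (key1 w h)
      · rw [key2 w h]
        exact Or.inr ⟨⟨w, rfl⟩, not_or.1 h⟩
    · rintro (rfl | ⟨⟨w, rfl⟩, h⟩)
      · exact ⟨u, key1 u (Or.inl huA)⟩
      · exact ⟨w, key2 w (not_or.2 h)⟩
  have hAR : A ∉ R := fun h => (Finset.mem_filter.1 h).2.1 huA
  have hBR : B ∉ R := fun h => (Finset.mem_filter.1 h).2.2 hvB
  have hABR : A ∪ B ∉ R := fun h =>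
    (Finset.mem_filter.1 h).2.1 (Finset.mem_union_left _ huA)
  have h0 : ∀ C : Finset V, 0 ≤ ∏ v ∈ C, lam v :=
    fun C => Finset.prod_nonneg fun v _ => (hlam v).1
  have h1 : ∀ C : Finset V, ∏ v ∈ C, lam v ≤ 1 :=
    fun C => Finset.prod_le_one (fun v _ => (hlam v).1) fun v _ => (hlam v).2.le
  have hP : 0 ≤ ∏ C ∈ R, (1 + ∏ v ∈ C, lam v) :=
    Finset.prod_nonneg fun C _ => by linarith [h0 C]
  rw [hX, hS, Finset.prod_insert hABR]
  by_cases hAB : A = B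
  · rw [← hAB, Finset.union_idempotent, Finset.insert_idem, Finset.prod_insert hAR]
    nlinarith [mul_nonneg (by linarith [h0 A] : 0 ≤ 1 + ∏ v ∈ A, lam v) hP]
  · have hdis : Disjoint A B := by
      rw [Finset.disjoint_left]
      intro z hz1 hz2
      exact hAB ((comp_eq_of_mem _ _ hz1).trans (comp_eq_of_mem _ _ hz2).symm)
    rw [Finset.prod_insert (by simp [hAB, hAR]), Finset.prod_insert hBR,
      Finset.prod_union hdis, ← mul_assoc, ← mul_assoc]
    refine mul_le_mul_of_nonneg_right ?_ hP
    nlinarith [mul_nonneg (sub_nonneg.2 (h1 A)) (sub_nonneg.2 (h1 B))]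

lemma rcWeight_pos {V E : Type} [Fintype V] [DecidableEq V] [DecidableEq E]
    (ends : E → V × V) (p : E → ℝ) (lam : V → ℝ)
    (hp : ∀ e, p e ∈ Set.Ioo (0 : ℝ) 1) (hlam : ∀ v, lam v ∈ Set.Ico (0 : ℝ) 1)
    (U S : Finset E) : 0 < rcWeight ends p lam U S := by
  unfold rcWeight
  refine mul_pos (mul_pos (Finset.prod_pos fun e _ => (hp e).1)
    (Finset.prod_pos fun e _ => sub_pos.2 (hp e).2)) (Finset.prod_pos fun C _ => ?_)
  have : 0 ≤ ∏ v ∈ C, lam v := Finset.prod_nonneg fun v _ => (hlam v).1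
  linarith

lemma rcWeight_ratio {V E : Type} [Fintype V] [DecidableEq V] [Fintype E] [DecidableEq E]
    (ends : E → V × V) (p : E → ℝ) (lam : V → ℝ)
    (hp : ∀ e, p e ∈ Set.Ioo (0 : ℝ) 1) (hlam : ∀ v, lam v ∈ Set.Ico (0 : ℝ) 1)
    (X : Finset E) (e : E) (he : e ∉ X) :
    p e * rcWeight ends p lam Finset.univ X ≤
      2 * (1 - p e) * rcWeight ends p lam Finset.univ (insert e X) := by
  have hF := comps_prod_le ends lam hlam X e
  have hc : (Finset.univ : Finset E) \ X = insert e (Finset.univ \ insert e X) := by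
    ext f
    by_cases hf : f = e <;> simp [hf, he]
  unfold rcWeight
  rw [Finset.prod_insert he, hc, Finset.prod_insert (by simp)]
  have ha : 0 < ∏ e ∈ X, p e := Finset.prod_pos fun e _ => (hp e).1
  have hb : 0 < ∏ e ∈ Finset.univ \ insert e X, (1 - p e) :=
    Finset.prod_pos fun e _ => sub_pos.2 (hp e).2
  have h1 := (hp e).1
  have h2 := sub_pos.2 (hp e).2
  have := mul_le_mul_of_nonneg_left hF (mul_pos (mul_pos ha hb) (mul_pos h1 h2)).le
  linarith

/-- **Lemma B.2 (marginal lower bound).** For a connected graph on `n ≥ 3` vertices with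
`(1-p_min)·log n ≤ e^{-40}` and `μ = μ^RC_{E,p,λ}`, every conditional marginal satisfies
`μ_e^T ≥ 1 - 3·(1-p_min)·log n`. -/
theorem rc_marginal_lower_bound {V E : Type} [Fintype V] [DecidableEq V] [Nonempty V]
    [Fintype E] [DecidableEq E] [Nonempty E]
    (ends : E → V × V) (hconn : GraphConnected ends)
    (hn : 3 ≤ Fintype.card V)
    (p : E → ℝ) (lam : V → ℝ)
    (hp : ∀ e, p e ∈ Set.Ioo (0 : ℝ) 1) (hlam : ∀ v, lam v ∈ Set.Ico (0 : ℝ) 1)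
    (hlow : (1 - Finset.univ.inf' Finset.univ_nonempty p) * Real.log (Fintype.card V) ≤
      Real.exp (-40)) :
    ∀ (T : Finset E) (e : E),
      1 - 3 * (1 - Finset.univ.inf' Finset.univ_nonempty p) * Real.log (Fintype.card V) ≤
        marg (rcProb ends p lam Finset.univ) T e := by
  intro T e
  set q := Finset.univ.inf' Finset.univ_nonempty p with hq
  have hqe : q ≤ p e := Finset.inf'_le _ (Finset.mem_univ e)
  have hlog : 1 ≤ Real.log (Fintype.card V) := by
    rw [Real.le_log_iff_exp_le (by positivity)]
    have : (3 : ℝ) ≤ Fintype.card V := by exact_mod_cast hn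
    linarith [Real.exp_one_lt_d9]
  have hp1 := (hp e).1
  have hp2 := (hp e).2
  have hr := rcWeight_ratio ends p lam hp hlam (T.erase e) e (Finset.notMem_erase e T)
  have hins : insert e (T.erase e) = insert e T := by
    ext f
    by_cases hf : f = e <;> simp [hf]
  rw [hins] at hr
  have hW1 := rcWeight_pos ends p lam hp hlam Finset.univ (insert e T)
  have hW0 := rcWeight_pos ends p lam hp hlam Finset.univ (T.erase e)
  have hZ : 0 < ∑ T ∈ (Finset.univ : Finset E).powerset, rcWeight ends p lam Finset.univ T :=
    Finset.sum_pos (fun S _ => rcWeight_pos ends p lam hp hlam _ S) ⟨∅, by simp⟩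
  unfold marg rcProb
  rw [if_pos (Finset.subset_univ _), if_pos (Finset.subset_univ _), ← add_div,
    div_div_div_cancel_right₀ hZ.ne', le_div_iff₀ (add_pos hW1 hW0)]
  set W1 := rcWeight ends p lam Finset.univ (insert e T)
  set W0 := rcWeight ends p lam Finset.univ (T.erase e)
  have hx : 2 * (1 - p e) ≤ 3 * (1 - q) * Real.log (Fintype.card V) := by
    nlinarith [mul_nonneg (by linarith : 0 ≤ 1 - q) (sub_nonneg.2 hlog)]
  have h2 : (1 - 3 * (1 - q) * Real.log (Fintype.card V)) * (W1 + W0) ≤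
      (1 - 2 * (1 - p e)) * (W1 + W0) :=
    mul_le_mul_of_nonneg_right (by linarith) (by linarith)
  refine h2.trans ?_
  nlinarith [mul_pos (sub_pos.2 hp2) hW0]
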